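/- Let f : S² → ℂ be a spherical harmonic of degree m. Then for every ψ ∈ S² and α ∈ ℝ, the average of f over the circle {(cos α)ψ + (sin α)σ : σ ∈ S¹_ψ} satisfies ∫_{S¹_ψ} f((cos α)ψ + (sin α)σ) dσ = (2π / C_m^{1/2}(1)) · C_m^{1/2}(cos α) · f(ψ), where S¹_ψ is the great circle of S² orthogonal to ψ and C_m^{1/2} is the Gegenbauer polynomial of order 1/2 and degree m (the Legendre polynomial P_m). -/

import Mathlib

/-- `f` restricted to the unit sphere of `ℝ³` is a spherical harmonic of degree `m`. -/
def IsSphericalHarmonic (m : ℕ) (f : EuclideanSpace ℝ (Fin 3) → ℂ) : Prop :=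
  ∃ P : MvPolynomial (Fin 3) ℂ, P.IsHomogeneous m ∧
    (∑ i : Fin 3, MvPolynomial.pderiv i (MvPolynomial.pderiv i P)) = 0 ∧
    ∀ x : EuclideanSpace ℝ (Fin 3), ‖x‖ = 1 →
      f x = MvPolynomial.eval (fun i => ((x i : ℝ) : ℂ)) P

/-- The Legendre polynomial `P_m = C_m^{1/2}` via the Rodrigues formula. -/
noncomputable def legendreP (m : ℕ) : Polynomial ℝ :=
  Polynomial.C (1 / (2 ^ m * m.factorial : ℝ)) *
    (Polynomial.derivative^[m] ((Polynomial.X ^ 2 - 1) ^ m))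

open scoped RealInnerProductSpace

theorem Finset.sum_range_filter_even {M : Type*} [AddCommMonoid M] (m : ℕ) (F : ℕ → M) :
    (∑ l ∈ Finset.range (m + 1), if 2 ∣ l then F l else 0) =
      ∑ j ∈ Finset.range (m / 2 + 1), F (2 * j) := by
  rw [← Finset.sum_filter]
  symm
  refine Finset.sum_bij (fun j _ => 2 * j) ?_ ?_ ?_ ?_
  · intro j hj
    simp only [Finset.mem_range, Finset.mem_filter] at hj ⊢
    omega
  · intro i _ j _ h
    simpa using h
  · intro l hl
    simp only [Finset.mem_range, Finset.mem_filter] at hl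
    obtain ⟨h, k, rfl⟩ := hl
    exact ⟨k, by simp only [Finset.mem_range]; omega, rfl⟩
  · intro j _
    rfl

/-- The central coefficient of `(X ^ 2 + b + a * X) ^ m`. -/
theorem Polynomial.coeff_trinomial_pow {R : Type*} [CommSemiring R] (m : ℕ) (a b : R) :
    ((X ^ 2 + C b + C a * X) ^ m : Polynomial R).coeff m =
      ∑ j ∈ Finset.range (m / 2 + 1),
        (m.choose (2 * j) * j.centralBinom : ℕ) * b ^ j * a ^ (m - 2 * j) := by
  have h : ∀ l ∈ Finset.range (m + 1),
      ((X ^ 2 + C b) ^ l * (C a * X) ^ (m - l) * (m.choose l : Polynomial R)).coeff m =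
        if 2 ∣ l then b ^ (l - l / 2) * (l.choose (l / 2)) * a ^ (m - l) * m.choose l else 0 := by
    intro l hl
    have hl' : l ≤ m := by simpa [Nat.lt_succ_iff] using hl
    have e : ((X ^ 2 + C b) ^ l : Polynomial R) = expand R 2 ((X + C b) ^ l) := by simp
    rw [e, ← C_eq_natCast, coeff_mul_C, mul_pow, ← C_pow, ← mul_assoc]
    conv_lhs => rw [← Nat.add_sub_cancel' hl']
    simp only [Nat.add_sub_cancel_left]
    rw [coeff_mul_X_pow, coeff_mul_C, coeff_expand two_pos]
    simp only [Nat.add_sub_cancel' hl']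
    split_ifs
    · rw [coeff_X_add_C_pow]
    · simp
  rw [add_pow, finsetSum_coeff, Finset.sum_congr rfl h, Finset.sum_range_filter_even]
  refine Finset.sum_congr rfl fun j _ => ?_
  rw [Nat.mul_div_cancel_left _ two_pos, Nat.centralBinom, show 2 * j - j = j by omega]
  push_cast
  ring

theorem eval_legendreP (m : ℕ) (c : ℝ) :
    (legendreP m).eval c = ∑ j ∈ Finset.range (m / 2 + 1),
      (m.choose (2 * j) * j.centralBinom : ℕ) * ((c ^ 2 - 1) / 4) ^ j * c ^ (m - 2 * j) := by
  open Polynomial in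
  have h : (derivative^[m] ((X ^ 2 - 1) ^ m : ℝ[X])).eval c =
      m.factorial * ((X ^ 2 + C (c ^ 2 - 1) + C (2 * c) * X) ^ m : ℝ[X]).coeff m := by
    have e : taylor c ((X ^ 2 - 1) ^ m : ℝ[X]) =
        (X ^ 2 + C (c ^ 2 - 1) + C (2 * c) * X) ^ m := by
      rw [taylor_pow, map_sub, taylor_pow, taylor_X, taylor_one]
      congr 1
      simp only [map_sub, map_mul, map_pow, map_one, map_ofNat]
      ring
    rw [← e, taylor_coeff, ← factorial_smul_hasseDeriv]
    simp
  have hm : (m.factorial : ℝ) ≠ 0 := by positivity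
  rw [legendreP, Polynomial.eval_mul, Polynomial.eval_C, h, Polynomial.coeff_trinomial_pow,
    ← mul_assoc, Finset.mul_sum]
  refine Finset.sum_congr rfl fun j hj => ?_
  have hj' : 2 * j ≤ m := by simp only [Finset.mem_range] at hj; omega
  have h2 : (2 : ℝ) ^ m = 4 ^ j * 2 ^ (m - 2 * j) := by
    rw [show (4 : ℝ) = 2 ^ 2 by norm_num, ← pow_mul, ← pow_add, Nat.add_sub_cancel' hj']
  rw [h2, div_pow, mul_pow]
  field_simp

theorem eval_one_legendreP (m : ℕ) : (legendreP m).eval 1 = 1 := by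
  rw [eval_legendreP, Finset.sum_range_succ']
  simp

namespace MvPolynomial

theorem pderiv_comm {σ R : Type*} [CommSemiring R] (i j : σ) (p : MvPolynomial σ R) :
    pderiv i (pderiv j p) = pderiv j (pderiv i p) := by
  classical
  ext d
  simp only [coeff_pderiv]
  by_cases h : i = j
  · subst h; rfl
  · simp [add_right_comm d, h, Ne.symm h]
    ring

/-- Chain rule for a linear substitution of variables. -/
theorem pderiv_aeval_linear {σ τ R : Type*} [Fintype σ] [Fintype τ] [CommSemiring R]
    (M : σ → τ → R) (j : τ) (p : MvPolynomial σ R) :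
    pderiv j (aeval (fun i => ∑ k, (C (M i k) * X k : MvPolynomial τ R)) p) =
      ∑ l, C (M l j) *
        aeval (fun i => ∑ k, (C (M i k) * X k : MvPolynomial τ R)) (pderiv l p) := by
  classical
  induction p using MvPolynomial.induction_on with
  | C a => simp
  | add p q hp hq => simp only [map_add, hp, hq, mul_add, Finset.sum_add_distrib]
  | mul_X p n hp =>
    set L : σ → MvPolynomial τ R := fun i => ∑ k, C (M i k) * X k with hL
    have hX : pderiv j (L n) = C (M n j) := by
      simp only [hL, map_sum, pderiv_C_mul, pderiv_X, Pi.single_apply]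
      simp
    have hS : ∑ l, C (M l j) * (aeval L p * aeval L (pderiv l (X n : MvPolynomial σ R))) =
        aeval L p * C (M n j) := by
      simp only [pderiv_X, Pi.single_apply, apply_ite, map_one, map_zero]
      simp [mul_comm]
    simp only [map_mul, pderiv_mul, aeval_X, hp, hX, map_add, mul_add, Finset.sum_add_distrib, hS]
    rw [Finset.sum_mul]
    simp only [mul_assoc]

/-- A linear substitution whose coefficients `M` satisfy `M₀M₀ᵀ + 2 (M₁M₂ᵀ + M₂M₁ᵀ) = 1` turns the
Laplacian into `∂₀² + 4 ∂₁∂₂`. -/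
theorem laplacian_aeval_linear {R : Type*} [CommRing R] {M : Fin 3 → Fin 3 → R}
    (hM : ∀ i k, M i 0 * M k 0 + 2 * (M i 1 * M k 2 + M k 1 * M i 2) = if i = k then 1 else 0)
    (P : MvPolynomial (Fin 3) R) :
    letI L : Fin 3 → MvPolynomial (Fin 3) R := fun i => ∑ k, C (M i k) * X k
    pderiv 0 (pderiv 0 (aeval L P)) + 4 * pderiv 1 (pderiv 2 (aeval L P)) =
      aeval L (∑ i, pderiv i (pderiv i P)) := by
  have hd := pderiv_aeval_linear M
  generalize (aeval (fun i => ∑ k, (C (M i k) * X k : MvPolynomial (Fin 3) R)) :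
    MvPolynomial (Fin 3) R →ₐ[R] MvPolynomial (Fin 3) R) = A at hd ⊢
  have hC : ∀ i k, (C (M i 0) * C (M k 0) + 2 * (C (M i 1) * C (M k 2) + C (M k 1) * C (M i 2)) :
      MvPolynomial (Fin 3) R) = if i = k then 1 else 0 := by
    intro i k
    have := congrArg (C (σ := Fin 3)) (hM i k)
    rw [show (2 : MvPolynomial (Fin 3) R) = C 2 from (map_ofNat _ 2).symm]
    split_ifs at this ⊢ <;> simpa using this
  have h00 := hC 0 0
  have h11 := hC 1 1
  have h22 := hC 2 2
  have h01 := hC 0 1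
  have h02 := hC 0 2
  have h12 := hC 1 2
  simp only [Fin.reduceEq, if_true, if_false] at h00 h11 h22 h01 h02 h12
  simp only [hd, map_sum, pderiv_C_mul]
  simp only [Fin.sum_univ_three]
  rw [pderiv_comm 1 0 P, pderiv_comm 2 0 P, pderiv_comm 2 1 P]
  linear_combination A (pderiv 0 (pderiv 0 P)) * h00 + A (pderiv 1 (pderiv 1 P)) * h11 +
    A (pderiv 2 (pderiv 2 P)) * h22 + 2 * A (pderiv 0 (pderiv 1 P)) * h01 +
    2 * A (pderiv 0 (pderiv 2 P)) * h02 + 2 * A (pderiv 1 (pderiv 2 P)) * h12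

/-- The exponent of `X 0 ^ i * X 1 ^ j * X 2 ^ j`. -/
noncomputable def diagExp (i j : ℕ) : Fin 3 →₀ ℕ :=
  Finsupp.single 0 i + Finsupp.single 1 j + Finsupp.single 2 j

theorem diagExp_zero (i j : ℕ) : diagExp i j 0 = i := by simp [diagExp]
theorem diagExp_one (i j : ℕ) : diagExp i j 1 = j := by simp [diagExp]
theorem diagExp_two (i j : ℕ) : diagExp i j 2 = j := by simp [diagExp]

/-- The recurrence for the diagonal coefficients of a harmonic polynomial in the coordinates
`z`, `x + i y`, `x - i y`. -/
theorem coeff_diagExp_recurrence {R : MvPolynomial (Fin 3) ℂ}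
    (hR : pderiv 0 (pderiv 0 R) + 4 * pderiv 1 (pderiv 2 R) = 0) (i j : ℕ) :
    ((i : ℂ) + 2) * (i + 1) * coeff (diagExp (i + 2) j) R +
      4 * ((j : ℂ) + 1) ^ 2 * coeff (diagExp i (j + 1)) R = 0 := by
  have h := congrArg (coeff (diagExp i j)) hR
  have e1 : diagExp i j + Finsupp.single 0 1 + Finsupp.single 0 1 = diagExp (i + 2) j := by
    ext k; fin_cases k <;> simp [diagExp]
  have e2 : diagExp i j + Finsupp.single 1 1 + Finsupp.single 2 1 = diagExp i (j + 1) := by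
    ext k; fin_cases k <;> simp [diagExp]
  rw [show (4 : MvPolynomial (Fin 3) ℂ) = C 4 from (map_ofNat C 4).symm, coeff_add, coeff_C_mul] at h
  simp only [coeff_pderiv, e1, e2, coeff_zero, Finsupp.add_apply, diagExp_zero, diagExp_one,
    diagExp_two] at h
  simp at h
  linear_combination h

theorem coeff_diagExp_eq {R : MvPolynomial (Fin 3) ℂ}
    (hR : pderiv 0 (pderiv 0 R) + 4 * pderiv 1 (pderiv 2 R) = 0) (m j : ℕ) (hj : 2 * j ≤ m) :
    coeff (diagExp (m - 2 * j) j) R =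
      (m.choose (2 * j) * j.centralBinom : ℕ) * (-1 / 4) ^ j * coeff (diagExp m 0) R := by
  induction j with
  | zero => simp
  | succ j ih =>
    have ih := ih (by omega)
    obtain ⟨i, rfl⟩ : ∃ i, m = i + 2 * (j + 1) := ⟨m - 2 * (j + 1), by omega⟩
    have hrec := coeff_diagExp_recurrence hR i j
    rw [Nat.add_sub_cancel]
    rw [show i + 2 * (j + 1) - 2 * j = i + 2 by omega] at ih
    rw [ih] at hrec
    have c1 := Nat.choose_succ_right_eq (i + 2 * (j + 1)) (2 * j)
    have c2 := Nat.choose_succ_right_eq (i + 2 * (j + 1)) (2 * j + 1)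
    have c3 := Nat.succ_mul_centralBinom_succ j
    rw [show i + 2 * (j + 1) - 2 * j = i + 2 by omega] at c1
    rw [show i + 2 * (j + 1) - (2 * j + 1) = i + 1 by omega] at c2
    rw [show 2 * j + 1 + 1 = 2 * (j + 1) by ring] at c2
    have hj1 : (4 : ℂ) * ((j : ℂ) + 1) ^ 2 ≠ 0 := by
      have : ((j : ℂ) + 1) ≠ 0 := by exact_mod_cast j.succ_ne_zero
      exact mul_ne_zero (by norm_num) (pow_ne_zero 2 this)
    apply mul_left_cancel₀ hj1
    have c1 := congrArg (Nat.cast (R := ℂ)) c1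
    have c2 := congrArg (Nat.cast (R := ℂ)) c2
    have c3 := congrArg (Nat.cast (R := ℂ)) c3
    push_cast at c1 c2 c3 hrec ⊢
    generalize (((i + 2 * (j + 1)).choose (2 * (j + 1)) : ℕ) : ℂ) = K2 at *
    generalize (((i + 2 * (j + 1)).choose (2 * j + 1) : ℕ) : ℂ) = K1 at *
    generalize (((i + 2 * (j + 1)).choose (2 * j) : ℕ) : ℂ) = K0 at *
    generalize ((j.centralBinom : ℕ) : ℂ) = B0 at *
    generalize (((j + 1).centralBinom : ℕ) : ℂ) = B1 at *
    generalize coeff (diagExp (i + 2 * (j + 1)) 0) R = A at *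
    have key : ((j : ℂ) + 1) ^ 2 * (K2 * B1) = ((i : ℂ) + 2) * (i + 1) * (K0 * B0) := by
      linear_combination ((j : ℂ) + 1) * K2 * c3 + (2 * j + 1) * B0 * c2 + (i + 1) * B0 * c1
    rw [pow_succ]
    linear_combination hrec + (-1 / 4) ^ j * A * key

end MvPolynomial

theorem integral_exp_sub_mul_I (j k : ℕ) :
    ∫ t in (-Real.pi)..Real.pi, Complex.exp (t * Complex.I) ^ j * Complex.exp (-(t * Complex.I)) ^ k =
      if j = k then (2 * Real.pi : ℂ) else 0 := by
  have e : ∀ t : ℝ, Complex.exp (t * Complex.I) ^ j * Complex.exp (-(t * Complex.I)) ^ k =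
      Complex.exp (((j : ℂ) - k) * Complex.I * t) := by
    intro t
    rw [← Complex.exp_nat_mul, ← Complex.exp_nat_mul, ← Complex.exp_add]
    congr 1
    ring
  simp only [e]
  split_ifs with h
  · subst h
    simp
    ring
  · have hc : ((j : ℂ) - k) * Complex.I ≠ 0 :=
      mul_ne_zero (sub_ne_zero.mpr (by exact_mod_cast h)) Complex.I_ne_zero
    rw [integral_exp_mul_complex hc]
    refine div_eq_zero_iff.mpr (Or.inl (sub_eq_zero.mpr ?_))
    refine Complex.exp_eq_exp_iff_exists_int.mpr ⟨(j : ℤ) - k, ?_⟩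
    push_cast
    ring

namespace MvPolynomial

/-- Averaging over a rotation in the variables `x + i y`, `x - i y` keeps the diagonal terms. -/
theorem IsHomogeneous.integral_eval_rotation {R : MvPolynomial (Fin 3) ℂ} {m : ℕ}
    (hR : R.IsHomogeneous m) (c s : ℂ) :
    ∫ t in (-Real.pi)..Real.pi, eval ![c, s * Complex.exp (t * Complex.I),
        s * Complex.exp (-(t * Complex.I))] R =
      2 * Real.pi * ∑ j ∈ Finset.range (m / 2 + 1),
        coeff (diagExp (m - 2 * j) j) R * (c ^ (m - 2 * j) * (s ^ 2) ^ j) := by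
  classical
  have e : ∀ t : ℝ, eval ![c, s * Complex.exp (t * Complex.I),
      s * Complex.exp (-(t * Complex.I))] R = ∑ d ∈ R.support,
        coeff d R * (c ^ d 0 * s ^ d 1 * s ^ d 2) *
          (Complex.exp (t * Complex.I) ^ d 1 * Complex.exp (-(t * Complex.I)) ^ d 2) := by
    intro t
    rw [eval_eq']
    refine Finset.sum_congr rfl fun d _ => ?_
    simp [Fin.prod_univ_three]
    ring
  simp only [e]
  rw [intervalIntegral.integral_finsetSum
    (fun d _ => Continuous.intervalIntegrable (by fun_prop) _ _)]
  simp only [intervalIntegral.integral_const_mul, integral_exp_sub_mul_I, mul_ite, mul_zero]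
  rw [← Finset.sum_filter, Finset.mul_sum]
  have hinj : Set.InjOn (fun j => diagExp (m - 2 * j) j) (Finset.range (m / 2 + 1)) := by
    intro j _ k _ h
    simpa [diagExp_one] using DFunLike.congr_fun h 1
  rw [Finset.sum_subset (s₂ := (Finset.range (m / 2 + 1)).image fun j => diagExp (m - 2 * j) j),
    Finset.sum_image hinj]
  · refine Finset.sum_congr rfl fun j _ => ?_
    rw [diagExp_zero, diagExp_one, diagExp_two]
    ring
  · intro d hd
    simp only [Finset.mem_filter, mem_support_iff] at hd
    have hdeg := hR hd.1
    rw [Finsupp.weight_apply, Finsupp.sum_fintype _ _ (by simp)] at hdeg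
    simp [Fin.sum_univ_three] at hdeg
    refine Finset.mem_image.mpr ⟨d 1, Finset.mem_range.mpr (by omega), ?_⟩
    ext k
    fin_cases k <;> simp [diagExp_zero, diagExp_one, diagExp_two] <;> omega
  · intro d hd hd'
    obtain ⟨j, -, rfl⟩ := Finset.mem_image.mp hd
    have : coeff (diagExp (m - 2 * j) j) R = 0 := by
      by_contra h
      exact hd' (Finset.mem_filter.mpr ⟨mem_support_iff.mpr h, by rw [diagExp_one, diagExp_two]⟩)
    simp [this]

end MvPolynomial

theorem Orthonormal.sum_mul_eq_ite {ι : Type*} [Fintype ι] [DecidableEq ι]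
    {b : ι → EuclideanSpace ℝ ι} (hb : Orthonormal ℝ b) (i k : ι) :
    ∑ l, b l i * b l k = if i = k then 1 else 0 := by
  let A : Matrix ι ι ℝ := Matrix.of fun l i => b l i
  have h : A * A.transpose = 1 := by
    ext l l'
    have := orthonormal_iff_ite.mp hb l l'
    rw [Matrix.mul_apply, Matrix.one_apply, ← this, PiLp.inner_apply]
    simp [A, Matrix.transpose_apply, mul_comm]
  have h' : A.transpose * A = 1 := mul_eq_one_comm.mp h
  have h' := congrFun (congrFun h' i) k
  simpa [A, Matrix.mul_apply, Matrix.one_apply] using h'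

/-- Funk–Hecke / zonal averaging identity: for a degree-`m` spherical harmonic `f`, `ψ` on
the sphere, and the great circle `S¹_ψ` orthogonal to `ψ` parameterized by an orthonormal
frame `u, v` of `ψ^⊥`,
`∫_{S¹_ψ} f(cos α · ψ + sin α · σ) dσ = (2π / P_m(1)) P_m(cos α) f(ψ)`. -/
theorem stmt8 (m : ℕ) (f : EuclideanSpace ℝ (Fin 3) → ℂ)
    (hf : IsSphericalHarmonic m f)
    (ψ u v : EuclideanSpace ℝ (Fin 3)) (hON : Orthonormal ℝ ![ψ, u, v]) (α : ℝ) :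
    ∫ s in (-Real.pi)..Real.pi,
        f (Real.cos α • ψ + Real.sin α • (Real.cos s • u + Real.sin s • v))
      = (((2 * Real.pi / (legendreP m).eval 1) : ℝ) : ℂ)
          * (((legendreP m).eval (Real.cos α) : ℝ) : ℂ) * f ψ := by
  obtain ⟨P, hP, hΔ, hfP⟩ := hf
  let M : Fin 3 → Fin 3 → ℂ := fun i =>
    ![(ψ i : ℂ), ((u i : ℂ) - v i * Complex.I) / 2, ((u i : ℂ) + v i * Complex.I) / 2]
  let L : Fin 3 → MvPolynomial (Fin 3) ℂ :=
    fun i => ∑ k, MvPolynomial.C (M i k) * MvPolynomial.X k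
  let R : MvPolynomial (Fin 3) ℂ := MvPolynomial.aeval L P
  have hRhom : R.IsHomogeneous m := by
    have := hP.aeval L (n := 1) fun i => MvPolynomial.IsHomogeneous.sum _ _ _ fun k _ =>
      MvPolynomial.isHomogeneous_C_mul_X _ _
    rwa [one_mul] at this
  have hframe : ∀ i k : Fin 3, (ψ i : ℂ) * ψ k + u i * u k + v i * v k = if i = k then 1 else 0 := by
    intro i k
    have := hON.sum_mul_eq_ite i k
    simp only [Fin.sum_univ_three, Matrix.cons_val] at this
    have := congrArg Complex.ofReal this
    push_cast at this
    split_ifs at this ⊢ <;> simpa using this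
  have hR : MvPolynomial.pderiv 0 (MvPolynomial.pderiv 0 R) +
      4 * MvPolynomial.pderiv 1 (MvPolynomial.pderiv 2 R) = 0 := by
    have hM : ∀ i k, M i 0 * M k 0 + 2 * (M i 1 * M k 2 + M k 1 * M i 2) =
        if i = k then 1 else 0 := by
      intro i k
      rw [← hframe i k]
      simp only [M, Matrix.cons_val]
      linear_combination (-(v i : ℂ) * v k) * Complex.I_sq
    rw [MvPolynomial.laplacian_aeval_linear hM P, hΔ, map_zero]
  have heval : ∀ w : Fin 3 → ℂ, MvPolynomial.eval w R =
      MvPolynomial.eval (fun i => ∑ k, M i k * w k) P := by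
    intro w
    have := MvPolynomial.aeval_bind₁ w L P
    rw [← MvPolynomial.aeval_eq_bind₁] at this
    simpa [L, R, MvPolynomial.aeval_eq_eval] using this
  have hψ : ‖ψ‖ = 1 := hON.1 0
  have hnorm : ∀ s : ℝ,
      ‖Real.cos α • ψ + Real.sin α • (Real.cos s • u + Real.sin s • v)‖ = 1 := by
    intro s
    have h := orthonormal_iff_ite.mp hON
    have h00 := h 0 0
    have h01 := h 0 1
    have h02 := h 0 2
    have h10 := h 1 0
    have h11 := h 1 1
    have h12 := h 1 2
    have h20 := h 2 0
    have h21 := h 2 1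
    have h22 := h 2 2
    simp only [Matrix.cons_val, Fin.reduceEq, if_true, if_false] at h00 h01 h02 h10 h11 h12 h20 h21 h22
    rw [← pow_eq_one_iff_of_nonneg (norm_nonneg _) two_ne_zero, ← real_inner_self_eq_norm_sq]
    simp only [inner_add_left, inner_add_right, real_inner_smul_left, real_inner_smul_right,
      h00, h01, h02, h10, h11, h12, h20, h21, h22]
    linear_combination Real.sin_sq_add_cos_sq α + Real.sin α ^ 2 * Real.sin_sq_add_cos_sq s
  have hint : ∀ s : ℝ, f (Real.cos α • ψ + Real.sin α • (Real.cos s • u + Real.sin s • v)) =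
      MvPolynomial.eval ![(Real.cos α : ℂ), (Real.sin α : ℂ) * Complex.exp (s * Complex.I),
        (Real.sin α : ℂ) * Complex.exp (-(s * Complex.I))] R := by
    intro s
    rw [hfP _ (hnorm s), heval]
    congr 2
    funext i
    rw [← neg_mul, Complex.exp_mul_I, Complex.exp_mul_I, Complex.cos_neg, Complex.sin_neg]
    simp [M, Fin.sum_univ_three]
    linear_combination (Complex.sin α * Complex.sin s * v i) * Complex.I_sq
  have htop : MvPolynomial.coeff (MvPolynomial.diagExp m 0) R = f ψ := by
    have h := hRhom.integral_eval_rotation 1 0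
    rw [Finset.sum_range_succ'] at h
    simp [heval, Fin.sum_univ_three, M] at h
    rw [hfP ψ hψ]
    have hpi : (Real.pi : ℂ) ≠ 0 := by exact_mod_cast Real.pi_ne_zero
    apply mul_left_cancel₀ (mul_ne_zero two_ne_zero hpi)
    rw [← h]
    ring
  simp only [hint]
  rw [hRhom.integral_eval_rotation, eval_one_legendreP, eval_legendreP, div_one]
  push_cast
  rw [mul_assoc (2 * (Real.pi : ℂ)), Finset.sum_mul]
  congr 1
  refine Finset.sum_congr rfl fun j hj => ?_
  rw [MvPolynomial.coeff_diagExp_eq hR m j (by simp only [Finset.mem_range] at hj; omega), htop,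
    Complex.sin_sq, show (Complex.cos α ^ 2 - 1) / 4 = (-1 / 4) * (1 - Complex.cos α ^ 2) by ring,
    mul_pow]
  push_cast
  ring
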